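/- Hugoniot relation for the parallel velocity: assume the Rankine–Hugoniot relation holds, W_I ≠ Z, and the positivity conditions μ_I + p_I > 0, μ_II + p_II > 0, μ_I + p_II > 0, μ_II + p_I > 0. Then ((μ_I + p_II)(μ_II + p_II))^{1/2} u∥_II = ((μ_I + p_I)(μ_II + p_I))^{1/2} u∥_I as vectors in ℝ^{d−1}; equivalently, u∥_II = ((μ_I+p_I)(μ_II+p_I)/((μ_I+p_II)(μ_II+p_II)))^{1/2} u∥_I. -/

import Mathlib

open Real

/-- Squared Euclidean norm of a vector. -/
noncomputable def nsq {n : ℕ} (w : Fin n → ℝ) : ℝ := ∑ j, (w j) ^ 2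

/-- Minkowski bilinear form on `ℝ^{d+1}`: `η(x,y) = -x₀y₀ + ∑_{j=1}^d xⱼyⱼ`. -/
noncomputable def eta {d : ℕ} (x y : Fin (d + 1) → ℝ) : ℝ :=
  -(x 0 * y 0) + ∑ j : Fin d, x j.succ * y j.succ

/-- Unit spacelike normal `V = (sinh Z, cosh Z, 0, …, 0)` to the interface. -/
noncomputable def normalV (d : ℕ) (Z : ℝ) : Fin (d + 1) → ℝ := fun i =>
  if i.val = 0 then Real.sinh Z else if i.val = 1 then Real.cosh Z else 0

/-- Unit timelike fluid velocity determined by the perpendicular rapidity `W` and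
the parallel velocity `w ∈ ℝ^{d-1}`. -/
noncomputable def vel (d : ℕ) (W : ℝ) (w : Fin (d - 1) → ℝ) : Fin (d + 1) → ℝ := fun i =>
  if i.val = 0 then Real.sqrt (1 + nsq w) * Real.cosh W
  else if i.val = 1 then Real.sqrt (1 + nsq w) * Real.sinh W
  else if h : i.val - 2 < d - 1 then w ⟨i.val - 2, h⟩ else 0

/-- The Rankine–Hugoniot relation
`(μ_II + p_II) η(u_II,V) u_II − (μ_I + p_I) η(u_I,V) u_I + (p_II − p_I) V = 0`. -/
def RH (d : ℕ) (μI pI μII pII : ℝ) (uI uII V : Fin (d + 1) → ℝ) : Prop :=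
  ∀ i, (μII + pII) * eta uII V * uII i - (μI + pI) * eta uI V * uI i + (pII - pI) * V i = 0

theorem nsq_nonneg {n : ℕ} (w : Fin n → ℝ) : 0 ≤ nsq w :=
  Finset.sum_nonneg fun _ _ => sq_nonneg _

/-- The normal component of the fluid velocity. -/
theorem eta_vel_normalV {d : ℕ} (hd : 1 ≤ d) (W Z : ℝ) (w : Fin (d - 1) → ℝ) :
    eta (vel d W w) (normalV d Z) = Real.sqrt (1 + nsq w) * Real.sinh (W - Z) := by
  obtain ⟨k, rfl⟩ : ∃ k, d = k + 1 := ⟨d - 1, by omega⟩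
  unfold eta
  rw [Fin.sum_univ_succ, Finset.sum_eq_zero (fun i _ => by simp [normalV])]
  simp only [vel, normalV, Fin.val_zero, Fin.val_succ, Real.sinh_sub]
  norm_num
  ring

/-- If `X - Y` is the pressure jump and `X (μI + pI + X) = Y (μII + pII + Y)`, then `X` and `Y` are
in the ratio of the mixed enthalpies. -/
theorem mixed_enthalpy_ratio {μI μII pI pII X Y : ℝ} (hXY : X - Y = pII - pI)
    (h : X * (μI + pI + X) = Y * (μII + pII + Y)) :
    X * (μI + pII) = Y * (μII + pI) := by
  linear_combination h - (X + Y) * hXY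

/-- Hugoniot relation for the parallel velocity. -/
theorem hugoniot_parallel_velocity (d : ℕ) (hd : 2 ≤ d) (Z μI μII pI pII WI WII : ℝ)
    (wI wII : Fin (d - 1) → ℝ) (hμI : 0 ≤ μI) (hμII : 0 ≤ μII)
    (hW : WI ≠ Z)
    (h1 : 0 < μI + pI) (h2 : 0 < μII + pII) (h3 : 0 < μI + pII) (h4 : 0 < μII + pI)
    (hRH : RH d μI pI μII pII (vel d WI wI) (vel d WII wII) (normalV d Z)) :
    (∀ j : Fin (d - 1),
        Real.sqrt ((μI + pII) * (μII + pII)) * wII j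
          = Real.sqrt ((μI + pI) * (μII + pI)) * wI j)
      ∧ ∀ j : Fin (d - 1),
          wII j = Real.sqrt ((μI + pI) * (μII + pI) / ((μI + pII) * (μII + pII))) * wI j := by
  obtain ⟨k, rfl⟩ : ∃ k, d = k + 1 := ⟨d - 1, by omega⟩
  simp only [RH, eta_vel_normalV (Nat.le_add_left 1 k)] at hRH
  have hR (w : Fin (k + 1 - 1) → ℝ) : 0 < Real.sqrt (1 + nsq w) :=
    Real.sqrt_pos.2 (by linarith [nsq_nonneg w])
  have hRsq (w : Fin (k + 1 - 1) → ℝ) : Real.sqrt (1 + nsq w) ^ 2 = 1 + nsq w :=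
    Real.sq_sqrt (by linarith [nsq_nonneg w])
  have e0 := hRH 0
  have e1 := hRH ⟨1, by omega⟩
  have ew (j : Fin (k + 1 - 1)) := hRH ⟨j.val + 2, by omega⟩
  simp only [vel, normalV, Fin.val_zero, if_true, one_ne_zero, if_false] at e0 e1
  simp [vel, normalV] at ew
  have hRI := hR wI
  have hRII := hR wII
  have hRIsq := hRsq wI
  have hRIIsq := hRsq wII
  set RI := Real.sqrt (1 + nsq wI)
  set RII := Real.sqrt (1 + nsq wII)
  set a := RI * Real.sinh (WI - Z) with ha
  set b := RII * Real.sinh (WII - Z) with hb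
  set A := μI + pI
  set B := μII + pII
  have ha0 : a ≠ 0 :=
    mul_ne_zero hRI.ne' (mt Real.sinh_eq_zero.1 (sub_ne_zero.2 hW))
  have normal : B * b ^ 2 - A * a ^ 2 + (pII - pI) = 0 := by
    have ha' : a = RI * (Real.sinh WI * Real.cosh Z - Real.cosh WI * Real.sinh Z) := by
      rw [ha, Real.sinh_sub]
    have hb' : b = RII * (Real.sinh WII * Real.cosh Z - Real.cosh WII * Real.sinh Z) := by
      rw [hb, Real.sinh_sub]
    linear_combination Real.cosh Z * e1 - Real.sinh Z * e0 + B * b * hb' - A * a * ha'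
      - (pII - pI) * Real.cosh_sq_sub_sinh_sq Z
  have tangential :
      B * b * (RII * Real.cosh (WII - Z)) = A * a * (RI * Real.cosh (WI - Z)) := by
    rw [Real.cosh_sub, Real.cosh_sub]
    linear_combination Real.cosh Z * e0 - Real.sinh Z * e1
  have parallel (j : Fin (k + 1 - 1)) : B * b * wII j = A * a * wI j := by
    linear_combination ew j
  have parallel_nsq : (B * b) ^ 2 * nsq wII = (A * a) ^ 2 * nsq wI := by
    simp only [nsq, Finset.mul_sum]
    exact Finset.sum_congr rfl fun j _ => by rw [← mul_pow, ← mul_pow, parallel j]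
  have hab : 0 < a * b := by
    have hcI := mul_pos hRI (Real.cosh_pos (WI - Z))
    have hcII := mul_pos hRII (Real.cosh_pos (WII - Z))
    have h : B * (RII * Real.cosh (WII - Z)) * (a * b)
        = A * a ^ 2 * (RI * Real.cosh (WI - Z)) := by
      linear_combination a * tangential
    refine pos_of_mul_pos_right (a := B * (RII * Real.cosh (WII - Z))) ?_ (by positivity)
    rw [h]
    positivity
  have hcI : (RI * Real.cosh (WI - Z)) ^ 2 = 1 + nsq wI + a ^ 2 := by
    rw [ha, mul_pow, mul_pow, Real.cosh_sq, hRIsq]; ring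
  have hcII : (RII * Real.cosh (WII - Z)) ^ 2 = 1 + nsq wII + b ^ 2 := by
    rw [hb, mul_pow, mul_pow, Real.cosh_sq, hRIIsq]; ring
  have ratio : A * a ^ 2 * (μI + pII) = B * b ^ 2 * (μII + pI) := by
    refine mixed_enthalpy_ratio (by linear_combination -normal) ?_
    have hsq := congrArg (· ^ 2) tangential
    simp only [mul_pow _ (RII * _), mul_pow _ (RI * _), hcI, hcII] at hsq
    linear_combination parallel_nsq - hsq
  have hb0 : b ≠ 0 := right_ne_zero_of_mul hab.ne'
  have hc : 0 < A * a / (B * b) := by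
    have : A * a / (B * b) = A * (a * b) / (B * b ^ 2) := by field_simp
    rw [this]
    positivity
  have hsqrt : Real.sqrt (A * (μII + pI) / ((μI + pII) * B)) = A * a / (B * b) := by
    rw [Real.sqrt_eq_iff_mul_self_eq_of_pos hc]
    field_simp
    linear_combination ratio
  have hvel (j : Fin (k + 1 - 1)) :
      wII j = Real.sqrt (A * (μII + pI) / ((μI + pII) * B)) * wI j := by
    rw [hsqrt, div_mul_eq_mul_div, eq_div_iff (by positivity)]
    linear_combination parallel j
  refine ⟨fun j => ?_, hvel⟩
  rw [hvel j, ← mul_assoc, ← Real.sqrt_mul (by positivity), mul_div_cancel₀ _ (by positivity)]
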